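/- Consider $\mathbb{C}^{2n}$ with symplectic basis $e_1, \ldots, e_n, e_1', \ldots, e_n'$ and standard symplectic form $\omega(e_i, e_j') = \delta_{ij}$, $\omega(e_i, e_j) = \omega(e_i', e_j') = 0$. Let $T' = (\mathbb{C}^*)^{n+2}$ act diagonally by $(t_1, \ldots, t_{n+2}) \cdot e_i = t_i t_{n+1} e_i$ and $(t_1, \ldots, t_{n+2}) \cdot e_i' = t_i^{-1} t_{n+2} e_i'$. If $Z \subseteq \mathbb{C}^{2n}$ is an irreducible $T'$-invariant Lagrangian subvariety, then there exist vectors $v_1, \ldots, v_n$ with $v_i \in \{e_i, e_i'\}$ such that $Z = \mathrm{span}_{\mathbb{C}}(v_1, \ldots, v_n)$. -/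

import Mathlib

noncomputable section
open MvPolynomial Module

/-- The symplectic vector space `ℂ²ⁿ`, with first factor spanned by `e₁,…,eₙ` and second factor
spanned by `e₁',…,eₙ'`. -/
abbrev Vn (n : ℕ) := (Fin n → ℂ) × (Fin n → ℂ)

/-- The standard symplectic form: `ω(eᵢ, eⱼ') = δᵢⱼ`, `ω(eᵢ,eⱼ) = ω(eᵢ',eⱼ') = 0`. -/
def omegaStd (n : ℕ) (p q : Vn n) : ℂ :=
  ∑ i, p.1 i * q.2 i - ∑ i, p.2 i * q.1 i

/-- `Z` is an (affine) algebraic subset of `ℂ²ⁿ`: the common zero locus of a set of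
polynomials. -/
def IsAlgSet {n : ℕ} (Z : Set (Vn n)) : Prop :=
  ∃ I : Set (MvPolynomial (Fin n ⊕ Fin n) ℂ),
    Z = {x : Vn n | ∀ P ∈ I, eval (Sum.elim x.1 x.2) P = 0}

/-- `Z` is an irreducible algebraic subset. -/
def IsIrredAlgSet {n : ℕ} (Z : Set (Vn n)) : Prop :=
  IsAlgSet Z ∧ Z.Nonempty ∧
    ∀ Z₁ Z₂ : Set (Vn n), IsAlgSet Z₁ → IsAlgSet Z₂ → Z ⊆ Z₁ ∪ Z₂ → Z ⊆ Z₁ ∨ Z ⊆ Z₂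

/-- `z` is a smooth point of `Z` of dimension `m`: the tangent cone of `Z` at `z` is an
`m`-dimensional linear subspace. -/
def IsSmoothPtOfDim {n : ℕ} (Z : Set (Vn n)) (z : Vn n) (m : ℕ) : Prop :=
  ∃ p : Submodule ℂ (Vn n), tangentConeAt ℂ Z z = (p : Set (Vn n)) ∧ finrank ℂ p = m

open Filter Topology Set

/-- The coordinates of a vector. -/
def evP {n : ℕ} (x : Vn n) : Fin n ⊕ Fin n → ℂ := Sum.elim x.1 x.2

/-- The coordinate functionals. -/
def coordL {n : ℕ} : Fin n ⊕ Fin n → (Vn n →L[ℂ] ℂ) :=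
  Sum.elim (fun i => (ContinuousLinearMap.proj i).comp (ContinuousLinearMap.fst ℂ _ _))
    (fun i => (ContinuousLinearMap.proj i).comp (ContinuousLinearMap.snd ℂ _ _))

theorem coordL_apply {n : ℕ} (i : Fin n ⊕ Fin n) (x : Vn n) : coordL i x = evP x i := by
  cases i <;> rfl

/-- Directional derivative of a polynomial. -/
def dirD {n : ℕ} (v : Vn n) (P : MvPolynomial (Fin n ⊕ Fin n) ℂ) :
    MvPolynomial (Fin n ⊕ Fin n) ℂ := ∑ i, C (evP v i) * pderiv i P

/-- The differential of a polynomial at a point. -/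
def dF {n : ℕ} (x : Vn n) (P : MvPolynomial (Fin n ⊕ Fin n) ℂ) : Vn n →L[ℂ] ℂ :=
  ∑ i, eval (evP x) (pderiv i P) • coordL i

theorem dF_apply {n : ℕ} (x v : Vn n) (P : MvPolynomial (Fin n ⊕ Fin n) ℂ) :
    dF x P v = ∑ i, eval (evP x) (pderiv i P) * evP v i := by
  simp [dF, coordL_apply]

theorem eval_dirD {n : ℕ} (x v : Vn n) (P : MvPolynomial (Fin n ⊕ Fin n) ℂ) :
    eval (evP x) (dirD v P) = dF x P v := by
  simp [dirD, dF_apply, mul_comm]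

theorem dF_X {n : ℕ} (x v : Vn n) (i : Fin n ⊕ Fin n) : dF x (X i) v = evP v i := by
  rw [dF_apply, Finset.sum_eq_single i]
  · simp
  · intro j _ hj
    rw [pderiv_X_of_ne (Ne.symm hj)]; simp
  · simp

theorem hasFDerivAt_eval {n : ℕ} (x : Vn n) (P : MvPolynomial (Fin n ⊕ Fin n) ℂ) :
    HasFDerivAt (fun y : Vn n => eval (evP y) P) (dF x P) x := by
  induction P using MvPolynomial.induction_on with
  | C a =>
    have : dF x (C a) = 0 := by
      refine ContinuousLinearMap.ext fun v => ?_
      simp [dF_apply]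
    rw [this]
    simp only [eval_C]
    exact hasFDerivAt_const _ _
  | add p q hp hq =>
    have : dF x (p + q) = dF x p + dF x q := by
      refine ContinuousLinearMap.ext fun v => ?_
      rw [ContinuousLinearMap.add_apply]
      simp only [dF_apply, map_add, add_mul, Finset.sum_add_distrib]
    rw [this]
    simp only [map_add]
    exact hp.add hq
  | mul_X p i hp =>
    have hX : HasFDerivAt (fun y : Vn n => evP y i) (coordL i) x := by
      have := (coordL (n := n) i).hasFDerivAt (x := x)
      have e : (coordL i : Vn n → ℂ) = fun y => evP y i := funext fun y => coordL_apply i y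
      rwa [e] at this
    have h := hp.mul hX
    have e : dF x (p * X i) = eval (evP x) p • coordL i + evP x i • dF x p := by
      refine ContinuousLinearMap.ext fun v => ?_
      have hx := dF_X x v i
      rw [dF_apply] at hx
      rw [ContinuousLinearMap.add_apply, ContinuousLinearMap.smul_apply,
        ContinuousLinearMap.smul_apply, coordL_apply, ← hx]
      simp only [dF_apply, Derivation.leibniz, map_add, smul_eq_mul, map_mul, eval_X, add_mul,
        Finset.sum_add_distrib, Finset.mul_sum, mul_assoc]
    rw [e]
    simp only [map_mul, eval_X]
    exact h

theorem contDiff_eval {n : ℕ} (P : MvPolynomial (Fin n ⊕ Fin n) ℂ) :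
    ContDiff ℝ 1 (fun y : Vn n => eval (evP y) P) := by
  have h : AnalyticOnNhd ℂ (fun y : Vn n => eval (fun i => coordL i y) P) univ :=
    AnalyticOnNhd.eval_continuousLinearMap' _ P
  have h2 : ContDiff ℂ 1 (fun y : Vn n => eval (fun i => coordL i y) P) := by
    rw [← contDiffOn_univ]
    exact h.contDiffOn uniqueDiffOn_univ
  simp only [coordL_apply] at h2
  exact h2.restrict_scalars ℝ

theorem continuous_evalP {n : ℕ} (P : MvPolynomial (Fin n ⊕ Fin n) ℂ) :
    Continuous (fun y : Vn n => eval (evP y) P) := (contDiff_eval P).continuous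

/-- Polynomials along curves. -/
theorem hasDerivAt_curve {n : ℕ} {γ : ℝ → Vn n} {v : Vn n} {t : ℝ} (h : HasDerivAt γ v t)
    (P : MvPolynomial (Fin n ⊕ Fin n) ℂ) :
    HasDerivAt (fun s => eval (evP (γ s)) P) (dF (γ t) P v) t := by
  have h1 := ((hasFDerivAt_eval (γ t) P).restrictScalars ℝ).comp_hasDerivAt t h
  exact h1

/-- Velocity vectors of curves lie in the tangent cone. -/
theorem mem_tangentCone_of_curve {n : ℕ} {Z : Set (Vn n)} {γ : ℝ → Vn n} {v : Vn n}
    (h : HasDerivAt γ v 0) {ε : ℝ} (hε : 0 < ε) (hZ : ∀ t ∈ Icc 0 ε, γ t ∈ Z) :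
    v ∈ tangentConeAt ℂ Z (γ 0) := by
  have h1 := h.hasDerivWithinAt (s := Ioi 0)
  rw [hasDerivWithinAt_iff_tendsto_slope' (by simp)] at h1
  refine mem_tangentConeAt_of_seq (𝓝[>] (0 : ℝ)) (fun t => ((t⁻¹ : ℝ) : ℂ))
    (fun t => γ t - γ 0) ?_ ?_ ?_
  · rw [tendsto_sub_nhds_zero_iff]
    exact h.continuousAt.tendsto.mono_left nhdsWithin_le_nhds
  · filter_upwards [Ioc_mem_nhdsGT hε] with t ht
    simpa using hZ t ⟨ht.1.le, ht.2⟩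
  · refine h1.congr' ?_
    filter_upwards with t
    simp only [slope, vsub_eq_sub, sub_zero]
    exact (Complex.coe_smul _ _).symm

/-- A solution of an ODE tangent to `Z` stays in `Z`. -/
theorem flow_mem {n : ℕ} {Z : Set (Vn n)} (hZ : IsAlgSet Z) (Y : Vn n → Vn n)
    (hY : ∀ P : MvPolynomial (Fin n ⊕ Fin n) ℂ, (∀ x ∈ Z, eval (evP x) P = 0) →
      ∃ Q : MvPolynomial (Fin n ⊕ Fin n) ℂ, (∀ x ∈ Z, eval (evP x) Q = 0) ∧
        ∀ x, dF x P (Y x) = eval (evP x) Q)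
    {γ : ℝ → Vn n} {ε : ℝ} (h0 : γ 0 ∈ Z)
    (hγ : ∀ t ∈ Icc 0 ε, HasDerivAt γ (Y (γ t)) t) : ∀ t ∈ Icc 0 ε, γ t ∈ Z := by
  obtain ⟨I, hI⟩ := hZ
  let J : Ideal (MvPolynomial (Fin n ⊕ Fin n) ℂ) :=
    { carrier := {P | ∀ x ∈ Z, eval (evP x) P = 0}
      add_mem' := fun {a b} ha hb x hx => by simp [ha x hx, hb x hx]
      zero_mem' := fun x hx => by simp
      smul_mem' := fun c a ha x hx => by simp [ha x hx] }
  have hJ : ∀ P, P ∈ J ↔ ∀ x ∈ Z, eval (evP x) P = 0 := fun P => Iff.rfl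
  have hfg : J.FG := IsNoetherian.noetherian J
  obtain ⟨m, G, hG⟩ := Submodule.fg_iff_exists_fin_generating_family.mp hfg
  have hGJ : ∀ k, G k ∈ J := fun k => by rw [← hG]; exact Submodule.subset_span ⟨k, rfl⟩
  choose Q hQ hQe using fun k => hY (G k) (hGJ k)
  have hQJ : ∀ k, ∃ a : Fin m → MvPolynomial (Fin n ⊕ Fin n) ℂ, ∑ l, a l • G l = Q k := by
    intro k
    have : Q k ∈ J := hQ k
    rw [← hG] at this
    exact (Submodule.mem_span_range_iff_exists_fun _).mp this
  choose a ha using hQJ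
  let A : Vn n → Fin m → Fin m → ℂ := fun x k l => eval (evP x) (a k l)
  let f : ℝ → Fin m → ℂ := fun t k => eval (evP (γ t)) (G k)
  let f' : ℝ → Fin m → ℂ := fun t k => ∑ l, A (γ t) k l * f t l
  have hf' : ∀ t ∈ Icc 0 ε, HasDerivAt f (f' t) t := by
    intro t ht
    rw [hasDerivAt_pi]
    intro k
    have := hasDerivAt_curve (hγ t ht) (G k)
    rw [hQe, ← ha] at this
    simpa [f', A, f] using this
  have hcont : ContinuousOn γ (Icc 0 ε) := fun t ht => (hγ t ht).continuousAt.continuousWithinAt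
  have hb : ∃ K : ℝ, 0 ≤ K ∧ ∀ t ∈ Icc 0 ε, ∀ k l, ‖A (γ t) k l‖ ≤ K := by
    have hc : ContinuousOn (fun t => A (γ t)) (Icc 0 ε) := by
      refine Continuous.comp_continuousOn (g := A) ?_ hcont
      exact continuous_pi fun k => continuous_pi fun l => continuous_evalP _
    obtain ⟨K, hK⟩ := isCompact_Icc.exists_bound_of_continuousOn hc
    refine ⟨max K 0, le_max_right _ _, fun t ht k l => ?_⟩
    exact ((norm_le_pi_norm (A (γ t) k) l).trans (norm_le_pi_norm (A (γ t)) k)).trans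
      ((hK t ht).trans (le_max_left _ _))
  obtain ⟨K, hK0, hK⟩ := hb
  have hz : ∀ t ∈ Icc 0 ε, f t = 0 := by
    refine eq_zero_of_abs_deriv_le_mul_abs_self_of_eq_zero_right (f' := f') (K := m * K)
      (fun t ht => (hf' t ht).continuousAt.continuousWithinAt)
      (fun t ht => (hf' t ⟨ht.1, ht.2.le⟩).hasDerivWithinAt) ?_ ?_
    · ext k
      exact hGJ k _ h0
    · intro t ht
      rw [pi_norm_le_iff_of_nonneg (by positivity)]
      intro k
      calc ‖f' t k‖ ≤ ∑ l, ‖A (γ t) k l * f t l‖ := norm_sum_le _ _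
        _ ≤ ∑ l : Fin m, K * ‖f t‖ := by
          refine Finset.sum_le_sum fun l _ => ?_
          rw [norm_mul]
          exact mul_le_mul (hK t ⟨ht.1, ht.2.le⟩ k l) (norm_le_pi_norm _ _) (norm_nonneg _) hK0
        _ = m * K * ‖f t‖ := by simp [mul_assoc]
  intro t ht
  have hall : ∀ P ∈ J, eval (evP (γ t)) P = 0 := by
    intro P hP
    rw [← hG] at hP
    obtain ⟨c, hc⟩ := (Submodule.mem_span_range_iff_exists_fun _).mp hP
    rw [← hc, map_sum]
    refine Finset.sum_eq_zero fun l _ => ?_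
    have : eval (evP (γ t)) (G l) = 0 := congrFun (hz t ht) l
    simp [this]
  rw [hI]
  intro P hP
  refine hall P fun x hx => ?_
  rw [hI] at hx
  exact hx P hP

/-- Generic points of an algebraic set have linear tangent cone. -/
theorem exists_smooth {n : ℕ} {Z : Set (Vn n)} (hZ : IsAlgSet Z)
    (h : MvPolynomial (Fin n ⊕ Fin n) ℂ) (hne : ∃ z ∈ Z, eval (evP z) h ≠ 0) :
    ∃ z ∈ Z, eval (evP z) h ≠ 0 ∧ ∃ p : Submodule ℂ (Vn n),
      tangentConeAt ℂ Z z = (p : Set (Vn n)) ∧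
      ∀ v ∈ p, ∀ P : MvPolynomial (Fin n ⊕ Fin n) ℂ, (∀ x ∈ Z, eval (evP x) P = 0) →
        dF z P v = 0 := by
  classical
  let J : Set (MvPolynomial (Fin n ⊕ Fin n) ℂ) := {P | ∀ x ∈ Z, eval (evP x) P = 0}
  let good : ℕ → Prop := fun r => ∃ z ∈ Z, eval (evP z) h ≠ 0 ∧
    ∃ (Ps : Fin r → MvPolynomial (Fin n ⊕ Fin n) ℂ) (w : Fin r → Vn n), (∀ i, Ps i ∈ J) ∧
      (Matrix.of fun i j => dF z (Ps i) (w j)).det ≠ 0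
  have g0 : good 0 := by
    obtain ⟨z, hz, hh⟩ := hne
    exact ⟨z, hz, hh, Fin.elim0, Fin.elim0, fun i => i.elim0, by simp⟩
  have gb : ∀ r, good r → r ≤ finrank ℂ (Vn n) := by
    rintro r ⟨z, hz, hh, Ps, w, hP, hdet⟩
    have : LinearIndependent ℂ w := by
      rw [Fintype.linearIndependent_iff]
      intro g hg
      have : (Matrix.of fun i j => dF z (Ps i) (w j)).mulVec g = 0 := by
        ext i
        have := congrArg (dF z (Ps i)) hg
        simpa [Matrix.mulVec, dotProduct, mul_comm] using this
      exact fun i => congrFun (Matrix.eq_zero_of_mulVec_eq_zero hdet this) i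
    simpa using this.fintype_card_le_finrank
  obtain ⟨r, hr, hmax⟩ : ∃ r, good r ∧ ¬ good (r + 1) := by
    by_contra! hcon
    have : ∀ r, good r := fun r => Nat.rec g0 (fun k hk => hcon k hk) r
    have := gb _ (this (finrank ℂ (Vn n) + 1))
    omega
  obtain ⟨z, hz, hh, Ps, w, hP, hdet⟩ := hr
  -- the minors vanish on the open set
  have hminor : ∀ P ∈ J, ∀ v : Vn n, ∀ x ∈ Z, eval (evP x) h ≠ 0 →
      (Matrix.of fun i j => dF x ((Fin.cons P Ps : Fin (r + 1) → _) i)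
        ((Fin.cons v w : Fin (r + 1) → Vn n) j)).det = 0 := by
    intro P hPJ v x hx hxh
    by_contra hd
    refine hmax ⟨x, hx, hxh, Fin.cons P Ps, Fin.cons v w, ?_, hd⟩
    intro i
    refine Fin.cases ?_ (fun i => ?_) i
    · simpa using hPJ
    · simpa using hP i
  refine ⟨z, hz, hh, ⨅ P : J, LinearMap.ker (dF z (P : MvPolynomial _ ℂ)).toLinearMap, ?_, ?_⟩
  swap
  · intro v hv P hPJ
    simp only [Submodule.mem_iInf] at hv
    exact hv ⟨P, hPJ⟩
  apply Set.Subset.antisymm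
  · intro v hv
    simp only [SetLike.mem_coe, Submodule.mem_iInf]
    rintro ⟨P, hPJ⟩
    rcases exists_fun_of_mem_tangentConeAt hv with ⟨ι, l, hl, c, d, hd₀, hds, hcd⟩
    have hlim := (hasFDerivAt_eval z P).hasFDerivWithinAt (s := Z) |>.lim hd₀ hds hcd
    have hlim0 : Tendsto (fun k => c k • (eval (evP (z + d k)) P - eval (evP z) P)) l (𝓝 0) := by
      refine tendsto_const_nhds.congr' ?_
      filter_upwards [hds] with k hk
      rw [hPJ _ hk, hPJ _ hz]; simp
    exact tendsto_nhds_unique hlim hlim0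
  · intro v hv
    simp only [SetLike.mem_coe, Submodule.mem_iInf] at hv
    have hv0 : ∀ P ∈ J, dF z P v = 0 := fun P hPJ => hv ⟨P, hPJ⟩
    set g := (Matrix.of fun i j => dF z (Ps i) (w j)).det with hg
    let v' : Vn n := (eval (evP z) h * g)⁻¹ • v
    let cols : Fin (r + 1) → Vn n := Fin.cons v' w
    -- cofactors
    let cf : Fin (r + 1) → MvPolynomial (Fin n ⊕ Fin n) ℂ := fun j =>
      (-1) ^ (j : ℕ) * (Matrix.of fun i k : Fin r => dirD (cols (j.succAbove k)) (Ps i)).det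
    have hcf : ∀ x j, eval (evP x) (cf j) = (-1) ^ (j : ℕ) *
        (Matrix.of fun i k : Fin r => dF x (Ps i) (cols (j.succAbove k))).det := by
      intro x j
      simp only [cf, map_mul, map_pow, map_neg, map_one, RingHom.map_det]
      congr 2
      ext i k
      simp [eval_dirD]
    let Y : Vn n → Vn n := fun x => ∑ j, eval (evP x) (h * cf j) • cols j
    have hYP : ∀ x P, dF x P (Y x) = eval (evP x) h *
        (Matrix.of fun i j => dF x ((Fin.cons P Ps : Fin (r + 1) → _) i) (cols j)).det := by
      intro x P
      rw [Matrix.det_succ_row_zero, Finset.mul_sum]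
      simp only [Y, map_sum, map_smul, map_mul, hcf, smul_eq_mul]
      refine Finset.sum_congr rfl fun j _ => ?_
      have : (Matrix.of fun i j => dF x ((Fin.cons P Ps : Fin (r + 1) → _) i) (cols j)).submatrix
          Fin.succ j.succAbove = Matrix.of fun i k : Fin r => dF x (Ps i) (cols (j.succAbove k)) := by
        ext i k; simp
      rw [this]
      simp
      ring
    have hYz : Y z = v := by
      have hz0 : ∀ j : Fin r, eval (evP z) (cf j.succ) = 0 := by
        intro j
        rw [hcf]
        have : NeZero r := ⟨fun hr0 => by subst hr0; exact j.elim0⟩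
        rw [Matrix.det_eq_zero_of_column_eq_zero (0 : Fin r), mul_zero]
        intro i
        have : (j.succ).succAbove (0 : Fin r) = 0 := Fin.succAbove_ne_zero_zero (Fin.succ_ne_zero j)
        simp only [Matrix.of_apply, this, cols, Fin.cons_zero, v', map_smul, hv0 _ (hP i), smul_zero]
      have hz1 : eval (evP z) (cf 0) = g := by
        rw [hcf]; simp [cols, hg]
      simp only [Y, Fin.sum_univ_succ, map_mul, hz0, hz1]
      simp only [mul_zero, zero_smul, Finset.sum_const_zero, add_zero, cols, Fin.cons_zero, v']
      rw [smul_smul, mul_inv_cancel₀ (mul_ne_zero hh hdet), one_smul]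
    have hYC : ContDiff ℝ 1 Y := by
      refine ContDiff.sum fun j _ => ?_
      exact (contDiff_eval (h * cf j)).smul contDiff_const
    obtain ⟨ρ, hρ, ε, hε, hsol⟩ :=
      (hYC.contDiffAt (x := z)).exists_forall_mem_closedBall_exists_eq_forall_mem_Ioo_hasDerivAt 0
    obtain ⟨γ, hγ0, hγ⟩ := hsol z (Metric.mem_closedBall_self hρ.le)
    have hγ' : ∀ t ∈ Icc 0 (ε / 2), HasDerivAt γ (Y (γ t)) t := by
      intro t ht
      exact hγ t ⟨by linarith [ht.1], by linarith [ht.2]⟩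
    have hmem := flow_mem hZ Y (fun P hPJ => by
      refine ⟨∑ j, h * cf j * dirD (cols j) P, fun x hx => ?_, fun x => ?_⟩
      · have h1 : eval (evP x) (∑ j, h * cf j * dirD (cols j) P) = dF x P (Y x) := by
          simp [Y, eval_dirD]
        rw [h1, hYP]
        by_cases hxh : eval (evP x) h = 0
        · rw [hxh, zero_mul]
        · rw [hminor P hPJ v' x hx hxh, mul_zero]
      · simp [Y, eval_dirD]) (by rw [hγ0]; exact hz) hγ'
    have hd := hγ' 0 ⟨le_rfl, by linarith⟩
    rw [hγ0, hYz] at hd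
    have := mem_tangentCone_of_curve hd (half_pos hε) hmem
    rwa [hγ0] at this

/-- An irreducible algebraic set meets the locus where finitely many nonvanishing coordinates are
all nonzero. -/
theorem exists_generic {n : ℕ} {Z : Set (Vn n)} (hirr : IsIrredAlgSet Z)
    (S : Finset (Fin n ⊕ Fin n)) (hS : ∀ i ∈ S, ∃ z ∈ Z, evP z i ≠ 0) :
    ∃ z ∈ Z, eval (evP z) (∏ i ∈ S, (X i : MvPolynomial (Fin n ⊕ Fin n) ℂ)) ≠ 0 := by
  classical
  induction S using Finset.induction_on with
  | empty =>
    obtain ⟨z, hz⟩ := hirr.2.1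
    exact ⟨z, hz, by simp⟩
  | insert a s ha ih =>
    obtain ⟨z₁, hz₁, h₁⟩ := ih fun i hi => hS i (Finset.mem_insert_of_mem hi)
    obtain ⟨z₂, hz₂, h₂⟩ := hS a (Finset.mem_insert_self _ _)
    by_contra! hcon
    have key := hirr.2.2 {x | ∀ P ∈ ({X a} : Set (MvPolynomial (Fin n ⊕ Fin n) ℂ)),
        eval (evP x) P = 0}
      {x | ∀ P ∈ ({∏ i ∈ s, X i} : Set (MvPolynomial (Fin n ⊕ Fin n) ℂ)), eval (evP x) P = 0}
      ⟨_, rfl⟩ ⟨_, rfl⟩ (by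
        intro z hz
        have := hcon z hz
        rw [Finset.prod_insert ha, map_mul, mul_eq_zero] at this
        rcases this with h | h
        · left; simpa using h
        · right
          intro P hP
          rw [Set.mem_singleton_iff] at hP
          rw [hP]; exact h)
    rcases key with h | h
    · exact h₂ (by simpa using h hz₂)
    · exact h₁ (h hz₁ _ rfl)

theorem isClosed_algSet {n : ℕ} {Z : Set (Vn n)} (hZ : IsAlgSet Z) : IsClosed Z := by
  obtain ⟨I, rfl⟩ := hZ
  have : {x : Vn n | ∀ P ∈ I, eval (Sum.elim x.1 x.2) P = 0} =
      ⋂ P ∈ I, {x : Vn n | eval (evP x) P = 0} := by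
    ext x; simp [evP]
  rw [this]
  exact isClosed_biInter fun P _ => isClosed_eq (continuous_evalP P) continuous_const

/-- Membership in a coordinate Lagrangian subspace. -/
theorem mem_coordSpan {n : ℕ} (f : Fin n → Bool) (x : Vn n) :
    x ∈ Submodule.span ℂ (Set.range fun i : Fin n =>
        if f i then ((Pi.single i 1, 0) : Vn n) else ((0, Pi.single i 1) : Vn n)) ↔
      ∀ i, (f i = true → x.2 i = 0) ∧ (f i = false → x.1 i = 0) := by
  constructor
  · intro hx
    induction hx using Submodule.span_induction with
    | mem y hy =>
      obtain ⟨j, rfl⟩ := hy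
      intro i
      by_cases hij : i = j
      · subst hij
        cases hf : f i <;> simp [hf]
      · cases hf : f j <;> simp [hf, Pi.single_apply, hij]
    | zero => intro i; simp
    | add y z _ _ hy hz =>
      intro i
      exact ⟨fun h => by simp [(hy i).1 h, (hz i).1 h], fun h => by simp [(hy i).2 h, (hz i).2 h]⟩
    | smul c y _ hy =>
      intro i
      exact ⟨fun h => by simp [(hy i).1 h], fun h => by simp [(hy i).2 h]⟩
  · intro h
    have : x = ∑ i, (x.1 i + x.2 i) • (if f i then ((Pi.single i 1, 0) : Vn n)
        else ((0, Pi.single i 1) : Vn n)) := by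
      refine Prod.ext ?_ ?_
      · ext j
        rw [Prod.fst_sum, Finset.sum_apply, Finset.sum_eq_single j]
        · cases hf : f j
          · simp [(h j).2 hf]
          · simp [(h j).1 hf]
        · intro i _ hij
          cases hf : f i <;> simp [Pi.single_apply, Ne.symm hij]
        · simp
      · ext j
        rw [Prod.snd_sum, Finset.sum_apply, Finset.sum_eq_single j]
        · cases hf : f j
          · simp [(h j).2 hf]
          · simp [(h j).1 hf]
        · intro i _ hij
          cases hf : f i <;> simp [Pi.single_apply, Ne.symm hij]
        · simp
    rw [this]
    exact Submodule.sum_mem _ fun i _ =>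
      Submodule.smul_mem _ _ (Submodule.subset_span ⟨i, rfl⟩)

/-- The real exponential as a unit. -/
def expU (t : ℝ) : ℂˣ := Units.mk0 (Complex.exp t) (Complex.exp_ne_zero _)

theorem expU_val (t : ℝ) : (expU t : ℂ) = Complex.exp t := rfl

theorem hasDerivAt_expU : HasDerivAt (fun t : ℝ => (expU t : ℂ)) 1 0 := by
  have := (Complex.hasDerivAt_exp (0 : ℝ)).comp_ofReal
  simpa [expU_val] using this

theorem hasDerivAt_expU_inv : HasDerivAt (fun t : ℝ => (((expU t)⁻¹ : ℂˣ) : ℂ)) (-1) 0 := by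
  have h := hasDerivAt_expU.inv (expU 0).ne_zero
  have e : (fun t : ℝ => (((expU t)⁻¹ : ℂˣ) : ℂ)) = (fun t : ℝ => (expU t : ℂ))⁻¹ := by
    ext t; simp
  rw [e]
  simpa [expU_val] using h

/-- An irreducible `T' = (ℂ*)^{n+2}`-invariant Lagrangian subvariety of `ℂ²ⁿ`
(`T'` acting by `eᵢ ↦ tᵢ t_{n+1} eᵢ`, `eᵢ' ↦ tᵢ⁻¹ t_{n+2} eᵢ'`) is a coordinate Lagrangian
subspace `span(v₁,…,vₙ)` with `vᵢ ∈ {eᵢ, eᵢ'}`. -/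
theorem stmt4 (n : ℕ) (Z : Set (Vn n))
    (hirr : IsIrredAlgSet Z)
    (hinv : ∀ (s : Fin n → ℂˣ) (u v : ℂˣ), ∀ z ∈ Z,
      ((fun i => (s i : ℂ) * (u : ℂ) * z.1 i,
        fun i => (((s i)⁻¹ : ℂˣ) : ℂ) * (v : ℂ) * z.2 i) : Vn n) ∈ Z)
    -- `Z` has dimension `n`: there is a smooth point, and every smooth point has an
    -- `n`-dimensional tangent space.
    (hsm : ∃ z ∈ Z, IsSmoothPtOfDim Z z n)
    (hdim : ∀ z ∈ Z, ∀ m, IsSmoothPtOfDim Z z m → m = n)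
    -- the symplectic form vanishes on the smooth locus of `Z`
    (hiso : ∀ z ∈ Z, IsSmoothPtOfDim Z z n →
      ∀ u ∈ tangentConeAt ℂ Z z, ∀ w ∈ tangentConeAt ℂ Z z, omegaStd n u w = 0) :
    ∃ f : Fin n → Bool,
      Z = ↑(Submodule.span ℂ (Set.range fun i : Fin n =>
        if f i then ((Pi.single i 1, 0) : Vn n) else ((0, Pi.single i 1) : Vn n))) := by
  classical
  -- a generic point with linear tangent cone
  let S : Finset (Fin n ⊕ Fin n) := Finset.univ.filter fun i => ∃ z ∈ Z, evP z i ≠ 0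
  obtain ⟨z, hz, hh, p, hp, hpJ⟩ := exists_smooth hirr.1 _
    (exists_generic hirr S fun i hi => (Finset.mem_filter.mp hi).2)
  have hcoord : ∀ i, evP z i = 0 → ∀ x ∈ Z, evP x i = 0 := by
    intro i hi x hx
    by_contra hxi
    have hiS : i ∈ S := Finset.mem_filter.mpr ⟨Finset.mem_univ _, x, hx, hxi⟩
    apply hh
    rw [map_prod]
    exact Finset.prod_eq_zero hiS (by simpa using hi)
  have hpcoord : ∀ i, evP z i = 0 → ∀ v ∈ p, evP v i = 0 := by
    intro i hi v hv
    rw [← dF_X z v i]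
    exact hpJ v hv _ fun x hx => by simpa using hcoord i hi x hx
  have hfin : finrank ℂ p = n := hdim z hz _ ⟨p, hp, rfl⟩
  have hsmz : IsSmoothPtOfDim Z z n := ⟨p, hp, hfin⟩
  -- torus directions
  have hu : ((z.1, 0) : Vn n) ∈ tangentConeAt ℂ Z z := by
    let γ : ℝ → Vn n := fun t => (fun i => (((1 : Fin n → ℂˣ) i : ℂˣ) : ℂ) * (expU t : ℂ) * z.1 i,
        fun i => ((((1 : Fin n → ℂˣ) i)⁻¹ : ℂˣ) : ℂ) * ((1 : ℂˣ) : ℂ) * z.2 i)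
    have h0 : γ 0 = z := by
      refine Prod.ext ?_ ?_ <;> ext i <;> simp [γ, expU_val]
    have hd : HasDerivAt γ ((z.1, 0) : Vn n) 0 := by
      refine HasDerivAt.prodMk ?_ ?_
      · rw [hasDerivAt_pi]
        intro i
        simpa using hasDerivAt_expU.mul_const (z.1 i)
      · rw [hasDerivAt_pi]
        intro i
        exact hasDerivAt_const _ _
    have := mem_tangentCone_of_curve (Z := Z) hd one_pos fun t _ => hinv 1 (expU t) 1 z hz
    rwa [h0] at this
  have hs : ∀ i, ((Pi.single i (z.1 i), Pi.single i (-z.2 i)) : Vn n) ∈ tangentConeAt ℂ Z z := by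
    intro i
    let s : ℝ → Fin n → ℂˣ := fun t => Function.update 1 i (expU t)
    let γ : ℝ → Vn n := fun t => (fun j => (s t j : ℂ) * ((1 : ℂˣ) : ℂ) * z.1 j,
        fun j => (((s t j)⁻¹ : ℂˣ) : ℂ) * ((1 : ℂˣ) : ℂ) * z.2 j)
    have h0 : γ 0 = z := by
      have : s 0 = 1 := by
        ext j
        by_cases hj : j = i
        · subst hj; simp [s, expU_val]
        · simp [s, hj]
      refine Prod.ext ?_ ?_ <;> ext j <;> simp [γ, this]
    have hd : HasDerivAt γ ((Pi.single i (z.1 i), Pi.single i (-z.2 i)) : Vn n) 0 := by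
      refine HasDerivAt.prodMk ?_ ?_
      · rw [hasDerivAt_pi]
        intro j
        by_cases hj : j = i
        · subst hj
          simpa [s] using hasDerivAt_expU.mul_const (z.1 j)
        · simpa [s, hj] using hasDerivAt_const (0 : ℝ) (z.1 j)
      · rw [hasDerivAt_pi]
        intro j
        by_cases hj : j = i
        · subst hj
          simpa [s] using hasDerivAt_expU_inv.mul_const (z.2 j)
        · simpa [s, hj] using hasDerivAt_const (0 : ℝ) (z.2 j)
    have := mem_tangentCone_of_curve (Z := Z) hd one_pos fun t _ => hinv (s t) 1 1 z hz
    rwa [h0] at this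
  have hprod : ∀ i, z.1 i * z.2 i = 0 := by
    intro i
    have := hiso z hz hsmz _ hu _ (hs i)
    simp only [omegaStd, Pi.single_apply] at this
    simpa using this
  let f : Fin n → Bool := fun i => decide (z.1 i ≠ 0)
  have hft : ∀ i, f i = true → z.1 i ≠ 0 := fun i hi => by simpa [f] using hi
  have hff : ∀ i, f i = false → z.1 i = 0 := fun i hi => by simpa [f] using hi
  have hft2 : ∀ i, f i = true → z.2 i = 0 := fun i hi =>
    (mul_eq_zero.mp (hprod i)).resolve_left (hft i hi)
  refine ⟨f, ?_⟩
  set L := Submodule.span ℂ (Set.range fun i : Fin n =>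
        if f i then ((Pi.single i 1, 0) : Vn n) else ((0, Pi.single i 1) : Vn n)) with hL
  have hpL : p ≤ L := by
    intro v hv
    rw [hL, mem_coordSpan]
    exact fun i => ⟨fun h => hpcoord (Sum.inr i) (hft2 i h) v hv,
      fun h => hpcoord (Sum.inl i) (hff i h) v hv⟩
  have hpeq : p = L := by
    refine Submodule.eq_of_le_of_finrank_le hpL ?_
    rw [hfin]
    simpa [Set.finrank] using finrank_range_le_card (R := ℂ) (fun i : Fin n =>
        if f i then ((Pi.single i 1, 0) : Vn n) else ((0, Pi.single i 1) : Vn n))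
  have hff2 : ∀ i, f i = false → z.2 i ≠ 0 := by
    intro i hi h0
    have hmem : ((0, Pi.single i 1) : Vn n) ∈ p := by
      rw [hpeq]
      exact Submodule.subset_span ⟨i, by simp [hi]⟩
    have := hpcoord (Sum.inr i) h0 _ hmem
    simp [evP] at this
  apply Set.Subset.antisymm
  · intro x hx
    rw [SetLike.mem_coe, hL, mem_coordSpan]
    exact fun i => ⟨fun h => hcoord (Sum.inr i) (hft2 i h) x hx,
      fun h => hcoord (Sum.inl i) (hff i h) x hx⟩
  · -- the open orbit is in `Z`
    have horb : ∀ x ∈ L, (∀ i, (f i = true → x.1 i ≠ 0) ∧ (f i = false → x.2 i ≠ 0)) → x ∈ Z := by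
      intro x hx hxne
      rw [hL, mem_coordSpan] at hx
      have hs : ∀ i, ∃ s : ℂˣ, (s : ℂ) * z.1 i = x.1 i ∧ ((s⁻¹ : ℂˣ) : ℂ) * z.2 i = x.2 i := by
        intro i
        cases hf : f i
        · have h1 := (hxne i).2 hf
          have h2 := hff2 i hf
          refine ⟨Units.mk0 (z.2 i / x.2 i) (div_ne_zero h2 h1), ?_, ?_⟩
          · rw [hff i hf, (hx i).2 hf, mul_zero]
          · simp; field_simp
        · have h1 := (hxne i).1 hf
          have h2 := hft i hf
          refine ⟨Units.mk0 (x.1 i / z.1 i) (div_ne_zero h1 h2), ?_, ?_⟩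
          · simp; field_simp
          · rw [hft2 i hf, (hx i).1 hf, mul_zero]
      choose s hs1 hs2 using hs
      have := hinv s 1 1 z hz
      simpa only [Units.val_one, mul_one, hs1, hs2] using this
    intro y hy
    have hzL : z ∈ L := by
      rw [hL, mem_coordSpan]
      exact fun i => ⟨hft2 i, hff i⟩
    have hev : ∀ᶠ t : ℂ in 𝓝[≠] 0, y + t • z ∈ Z := by
      have hne : ∀ a b : ℂ, b ≠ 0 → ∀ᶠ t : ℂ in 𝓝[≠] 0, a + t * b ≠ 0 := by
        intro a b hb
        by_cases ha : a = 0
        · subst ha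
          filter_upwards [self_mem_nhdsWithin] with t ht
          simpa using ⟨ht, hb⟩
        · have hc : Tendsto (fun t : ℂ => a + t * b) (𝓝[≠] 0) (𝓝 a) := by
            have : Continuous fun t : ℂ => a + t * b := by fun_prop
            simpa using (this.tendsto 0).mono_left nhdsWithin_le_nhds
          exact hc.eventually_ne ha
      have hall : ∀ᶠ t : ℂ in 𝓝[≠] 0, ∀ i, (f i = true → (y + t • z).1 i ≠ 0) ∧
          (f i = false → (y + t • z).2 i ≠ 0) := by
        rw [eventually_all]
        intro i
        cases hf : f i
        · filter_upwards [hne (y.2 i) (z.2 i) (hff2 i hf)] with t ht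
          simpa using ht
        · filter_upwards [hne (y.1 i) (z.1 i) (hft i hf)] with t ht
          simpa using ht
      filter_upwards [hall] with t ht
      exact horb _ (L.add_mem hy (L.smul_mem t hzL)) ht
    have hlim : Tendsto (fun t : ℂ => y + t • z) (𝓝[≠] 0) (𝓝 y) := by
      have : Continuous fun t : ℂ => y + t • z := by fun_prop
      simpa using (this.tendsto 0).mono_left nhdsWithin_le_nhds
    exact (isClosed_algSet hirr.1).mem_of_tendsto hlim hev
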